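/- The map q ↦ M(q), restricted to the unit sphere {q : ℍ // ‖q‖ = 1} of the real quaternions and regarded as a map into SO(3), is a covering map, and every fiber has exactly two elements (consisting of a unit quaternion q and its negative −q). -/

import Mathlib

/-- For a quaternion `a = x + y·i + z·j + w·k`, the associated `3 × 3` real matrix of the
rotation it induces on `ℝ³` (Rodrigues / Euler–Rodrigues formula). -/
noncomputable def quatToMatrix (a : Quaternion ℝ) : Matrix (Fin 3) (Fin 3) ℝ :=
  !![a.re ^ 2 + a.imI ^ 2 - a.imJ ^ 2 - a.imK ^ 2,
      2 * (a.imI * a.imJ - a.re * a.imK),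
      2 * (a.imI * a.imK + a.re * a.imJ);
    2 * (a.imI * a.imJ + a.re * a.imK),
      a.re ^ 2 - a.imI ^ 2 + a.imJ ^ 2 - a.imK ^ 2,
      2 * (a.imJ * a.imK - a.re * a.imI);
    2 * (a.imI * a.imK - a.re * a.imJ),
      2 * (a.imJ * a.imK + a.re * a.imI),
      a.re ^ 2 - a.imI ^ 2 - a.imJ ^ 2 + a.imK ^ 2]

open Matrix

namespace Quaternion

/-- The unit sphere of the real quaternions. -/
abbrev UnitSphere : Type := {q : Quaternion ℝ // ‖q‖ = 1}

theorem norm_eq_one_iff (q : Quaternion ℝ) :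
    ‖q‖ = 1 ↔ q.re ^ 2 + q.imI ^ 2 + q.imJ ^ 2 + q.imK ^ 2 = 1 := by
  rw [← normSq_def', normSq_eq_norm_mul_self, ← sq, pow_eq_one_iff_of_nonneg (norm_nonneg q)
    two_ne_zero]

instance : CompactSpace UnitSphere := by
  have h : IsCompact {q : Quaternion ℝ | ‖q‖ = 1} := by
    simpa [Metric.sphere] using isCompact_sphere (0 : Quaternion ℝ) 1
  exact isCompact_iff_compactSpace.mp h

theorem norm_intUnits_smul (u : ℤˣ) (q : Quaternion ℝ) : ‖u • q‖ = ‖q‖ := by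
  rcases Int.units_eq_one_or u with rfl | rfl <;> simp [Units.smul_def]

/-- The sign group `ℤˣ = {1, -1}` acts on the unit quaternions. -/
instance : MulAction ℤˣ UnitSphere where
  smul u q := ⟨u • q.1, (norm_intUnits_smul u q.1).trans q.2⟩
  one_smul q := Subtype.ext (one_smul ℤˣ q.1)
  mul_smul u v q := Subtype.ext (mul_smul u v q.1)

theorem UnitSphere.coe_smul (u : ℤˣ) (q : UnitSphere) :
    ((u • q : UnitSphere) : Quaternion ℝ) = u • (q : Quaternion ℝ) := rfl

theorem UnitSphere.mem_orbit_iff (p q : UnitSphere) :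
    p ∈ MulAction.orbit ℤˣ q ↔ p.1 = q.1 ∨ p.1 = -q.1 := by
  constructor
  · rintro ⟨u, rfl⟩
    rcases Int.units_eq_one_or u with rfl | rfl <;> simp [UnitSphere.coe_smul, Units.smul_def]
  · rintro (h | h)
    · exact ⟨1, Subtype.ext (by simp [h])⟩
    · exact ⟨-1, Subtype.ext (by simp [h, UnitSphere.coe_smul, Units.smul_def])⟩

instance : ContinuousConstSMul ℤˣ UnitSphere where
  continuous_const_smul u := by
    refine Continuous.subtype_mk ?_ _
    exact continuous_subtype_val.const_smul (u : ℤ)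

/-- Balls of radius `1` around a unit quaternion are disjoint from their antipodes. -/
theorem UnitSphere.exists_nhds_smul_disjoint (e : UnitSphere) :
    ∃ U ∈ nhds e, ∀ u : ℤˣ, ((u • ·) '' U ∩ U).Nonempty → u = 1 := by
  refine ⟨Metric.ball e 1, Metric.ball_mem_nhds e one_pos, fun u hu => ?_⟩
  rcases Int.units_eq_one_or u with rfl | rfl
  · rfl
  obtain ⟨_, ⟨p, hp, rfl⟩, hq⟩ := hu
  rw [Metric.mem_ball, Subtype.dist_eq, dist_eq_norm] at hp hq
  have h : (((-1 : ℤˣ) • p : UnitSphere) : Quaternion ℝ) = -p.1 := by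
    simp [UnitSphere.coe_smul, Units.smul_def]
  rw [h] at hq
  have key : ‖(2 : ℝ) • e.1‖ ≤ ‖p.1 - e.1‖ + ‖-p.1 - e.1‖ := by
    rw [← norm_neg ((2 : ℝ) • e.1)]
    convert norm_add_le (p.1 - e.1) (-p.1 - e.1) using 2
    module
  rw [norm_smul, e.2] at key
  norm_num at key
  linarith

theorem eq_or_eq_neg_of_quatToMatrix_eq {p q : Quaternion ℝ} (hp : ‖p‖ = 1) (hq : ‖q‖ = 1)
    (h : quatToMatrix p = quatToMatrix q) : p = q ∨ p = -q := by
  rw [norm_eq_one_iff] at hp hq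
  have e (i j : Fin 3) := congrFun (congrFun h i) j
  have h00 := e 0 0
  have h01 := e 0 1
  have h02 := e 0 2
  have h10 := e 1 0
  have h11 := e 1 1
  have h12 := e 1 2
  have h20 := e 2 0
  have h21 := e 2 1
  have h22 := e 2 2
  simp [quatToMatrix] at h00 h01 h02 h10 h11 h12 h20 h21 h22
  obtain ⟨a, b, c, d⟩ := p
  obtain ⟨x, y, z, w⟩ := q
  dsimp only at *
  have haa : a * a = x * x := by linarith
  have hbb : b * b = y * y := by linarith
  have hcc : c * c = z * z := by linarith
  have hdd : d * d = w * w := by linarith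
  have hab : a * b = x * y := by linarith
  have hac : a * c = x * z := by linarith
  have had : a * d = x * w := by linarith
  have hbc : b * c = y * z := by linarith
  have hbd : b * d = y * w := by linarith
  have hcd : c * d = z * w := by linarith
  clear h00 h01 h02 h10 h11 h12 h20 h21 h22 e h
  -- `p = t • q` where `t` is the inner product of `p` and `q`
  obtain ⟨t, ht⟩ : ∃ t, t = a * x + b * y + c * z + d * w := ⟨_, rfl⟩
  have ha : a = t * x := by grind
  have hb : b = t * y := by grind
  have hc : c = t * z := by grind
  have hd : d = t * w := by grind
  have ht2 : t ^ 2 = 1 := by grind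
  rcases (sq_eq_sq_iff_eq_or_eq_neg.mp (ht2.trans (one_pow 2).symm)) with h | h
  · rw [h, one_mul] at ha hb hc hd
    exact .inl (Quaternion.ext _ _ ha hb hc hd)
  · rw [h, neg_one_mul] at ha hb hc hd
    exact .inr (Quaternion.ext _ _ ha hb hc hd)

/-- A real square array of trace `1` whose `2 × 2` minors vanish is of the form `v vᵀ`. -/
theorem exists_mul_eq_of_minors_eq_zero {ι : Type*} [Fintype ι] {Q : ι → ι → ℝ}
    (htr : ∑ i, Q i i = 1) (hQ : ∀ i j k, Q i i * Q j k = Q i j * Q i k) :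
    ∃ v : ι → ℝ, ∀ j k, v j * v k = Q j k := by
  obtain ⟨i, -, hi⟩ : ∃ i ∈ Finset.univ, 0 < Q i i :=
    Finset.exists_lt_of_sum_lt (f := fun _ => (0 : ℝ)) (by simp [htr])
  refine ⟨fun j => Q i j / √(Q i i), fun j k => ?_⟩
  rw [div_mul_div_comm, Real.mul_self_sqrt hi.le, ← hQ, mul_div_cancel_left₀ _ hi.ne']

/-- The symmetric array `q qᵀ` expressed through the entries of the rotation matrix of `q`. -/
noncomputable def outerOfRotation (A : Matrix (Fin 3) (Fin 3) ℝ) : Matrix (Fin 4) (Fin 4) ℝ :=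
  (4 : ℝ)⁻¹ •
  !![1 + A 0 0 + A 1 1 + A 2 2, A 2 1 - A 1 2, A 0 2 - A 2 0, A 1 0 - A 0 1;
    A 2 1 - A 1 2, 1 + A 0 0 - A 1 1 - A 2 2, A 0 1 + A 1 0, A 0 2 + A 2 0;
    A 0 2 - A 2 0, A 0 1 + A 1 0, 1 - A 0 0 + A 1 1 - A 2 2, A 1 2 + A 2 1;
    A 1 0 - A 0 1, A 0 2 + A 2 0, A 1 2 + A 2 1, 1 - A 0 0 - A 1 1 + A 2 2]

set_option maxHeartbeats 1000000 in
theorem outerOfRotation_minors {A : Matrix (Fin 3) (Fin 3) ℝ} (hA : Aᵀ * A = 1) (hd : A.det = 1)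
    (i j k : Fin 4) :
    outerOfRotation A i i * outerOfRotation A j k =
      outerOfRotation A i j * outerOfRotation A i k := by
  have hA' : A * Aᵀ = 1 := mul_eq_one_comm.mp hA
  have hadj : A.adjugate = Aᵀ := by
    calc A.adjugate = Aᵀ * A * A.adjugate := by rw [hA, one_mul]
      _ = Aᵀ := by rw [mul_assoc, mul_adjugate, hd, one_smul, mul_one]
  rw [adjugate_fin_three] at hadj
  simp only [← Matrix.ext_iff, Fin.forall_fin_succ, Matrix.mul_apply, Fin.sum_univ_three,
    Matrix.transpose_apply, Matrix.one_apply] at hA hA' hadj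
  simp at hA hA' hadj
  obtain ⟨⟨p1, p2, p3⟩, ⟨-, p4, p5⟩, -, -, p6⟩ := hA
  obtain ⟨⟨r1, r2, r3⟩, ⟨-, r4, r5⟩, -, -, r6⟩ := hA'
  obtain ⟨⟨c1, c2, c3⟩, ⟨c4, c5, c6⟩, c7, c8, c9⟩ := hadj
  fin_cases i <;> fin_cases j <;> fin_cases k <;> simp [outerOfRotation] <;> linarith

theorem exists_quatToMatrix_eq {A : Matrix (Fin 3) (Fin 3) ℝ} (hA : Aᵀ * A = 1) (hd : A.det = 1) :
    ∃ q : Quaternion ℝ, ‖q‖ = 1 ∧ quatToMatrix q = A := by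
  obtain ⟨v, hv⟩ := exists_mul_eq_of_minors_eq_zero (Q := outerOfRotation A)
    (by simp [Fin.sum_univ_four, outerOfRotation]; ring) (outerOfRotation_minors hA hd)
  simp only [Fin.forall_fin_succ, outerOfRotation] at hv
  simp at hv
  refine ⟨⟨v 0, v 1, v 2, v 3⟩, (norm_eq_one_iff _).mpr ?_, ?_⟩
  · dsimp only
    linarith
  · ext i j
    fin_cases i <;> fin_cases j <;> simp [quatToMatrix] <;> linarith

theorem quatToMatrix_transpose_mul_self {q : Quaternion ℝ} (hq : ‖q‖ = 1) :
    (quatToMatrix q)ᵀ * quatToMatrix q = 1 := by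
  rw [norm_eq_one_iff] at hq
  ext i j
  fin_cases i <;> fin_cases j <;>
    simp [quatToMatrix, Matrix.mul_apply, Fin.sum_univ_three] <;> grind

theorem det_quatToMatrix {q : Quaternion ℝ} (hq : ‖q‖ = 1) : (quatToMatrix q).det = 1 := by
  rw [norm_eq_one_iff] at hq
  trans (q.re ^ 2 + q.imI ^ 2 + q.imJ ^ 2 + q.imK ^ 2) ^ 3
  · simp [quatToMatrix, det_fin_three]
    ring
  · rw [hq, one_pow]

theorem quatToMatrix_neg (q : Quaternion ℝ) : quatToMatrix (-q) = quatToMatrix q := by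
  simp [quatToMatrix]

theorem continuous_quatToMatrix : Continuous quatToMatrix := by
  refine continuous_matrix fun i j => ?_
  have := continuous_re
  have := continuous_imI
  have := continuous_imJ
  have := continuous_imK
  fin_cases i <;> fin_cases j <;> simp [quatToMatrix] <;> fun_prop

/-- The map from the unit quaternions to `SO(3)`. -/
noncomputable def toRotation (q : UnitSphere) :
    {A : Matrix (Fin 3) (Fin 3) ℝ // Aᵀ * A = 1 ∧ A.det = 1} :=
  ⟨quatToMatrix q.1, quatToMatrix_transpose_mul_self q.2, det_quatToMatrix q.2⟩

theorem toRotation_surjective : Function.Surjective toRotation := fun A =>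
  let ⟨q, hq, h⟩ := exists_quatToMatrix_eq A.2.1 A.2.2
  ⟨⟨q, hq⟩, Subtype.ext h⟩

theorem isQuotientCoveringMap_toRotation : IsQuotientCoveringMap toRotation ℤˣ where
  toIsQuotientMap :=
    have hc : Continuous toRotation :=
      (continuous_quatToMatrix.comp continuous_subtype_val).subtype_mk _
    .of_surjective_continuous toRotation_surjective hc
  apply_eq_iff_mem_orbit {p q} := by
    rw [UnitSphere.mem_orbit_iff, Subtype.ext_iff]
    refine ⟨eq_or_eq_neg_of_quatToMatrix_eq p.2 q.2, ?_⟩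
    rintro (h | h) <;> simp [toRotation, h, quatToMatrix_neg]
  disjoint := UnitSphere.exists_nhds_smul_disjoint

end Quaternion

theorem stmt_14 :
    ∃ Φ : {q : Quaternion ℝ // ‖q‖ = 1} →
          {A : Matrix (Fin 3) (Fin 3) ℝ // Aᵀ * A = 1 ∧ A.det = 1},
      (∀ q, (Φ q : Matrix (Fin 3) (Fin 3) ℝ) = quatToMatrix q.1) ∧
      IsCoveringMap Φ ∧
      (∀ A, Nat.card (Φ ⁻¹' {A}) = 2) ∧
      (∀ q : {q : Quaternion ℝ // ‖q‖ = 1},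
        Φ ⟨-q.1, by rw [norm_neg]; exact q.2⟩ = Φ q) := by
  have h := Quaternion.isQuotientCoveringMap_toRotation
  refine ⟨Quaternion.toRotation, fun _ => rfl, h.isCoveringMap, fun A => ?_,
    fun q => Subtype.ext (Quaternion.quatToMatrix_neg q.1)⟩
  obtain ⟨q, hq⟩ := h.surjective A
  rw [Nat.card_congr (h.fiberEquivGroup ⟨q, hq⟩), Nat.card_eq_fintype_card, Fintype.card_units_int]
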